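/- Assume cov(M) = 𝔠, i.e., the real line is not the union of fewer than continuum many meager sets. Let X be a semigroup admitting a topology τ that is power-Lindelöf and subinvariant. Suppose that for every homomorphism h : X → Y into a Tychonoff (completely regular Hausdorff) topological semigroup Y, the image h[X] is closed in Y. Then X is polybounded. -/

import Mathlib

open Cardinal Pointwise

universe u

namespace ZeroClosedPaper

/-- The value of the semigroup polynomial with coefficient list `a = [a₀, a₁, …, aₙ]`
(coefficients in `X¹ = WithOne X`) at the point `x`, i.e. `a₀xa₁x⋯xaₙ`,
computed in the monoid `WithOne X`. Its degree (the number of occurrences of `x`)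
is `a.length - 1`. -/
def polyVal {X : Type*} [Semigroup X] (a : List (WithOne X)) (x : X) : WithOne X :=
  match a with
  | [] => 1
  | a₀ :: rest => a₀ * (rest.map (fun ai => (x : WithOne X) * ai)).prod

/-- A subset `A` of a semigroup `X` is algebraic if
`A = {x ∈ X : a₀xa₁⋯xaₙ = b}` for some `n ≥ 1`, `b ∈ X` and `a₀,…,aₙ ∈ X¹`. -/
def IsAlgebraicSet {X : Type*} [Semigroup X] (A : Set X) : Prop :=
  ∃ (a : List (WithOne X)) (b : X), 2 ≤ a.length ∧
    A = {x : X | polyVal a x = (b : WithOne X)}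

/-- The polyboundedness number `cov(A_X)`: the smallest cardinality of a cover of `X`
by algebraic subsets of `X`. -/
noncomputable def covA (X : Type*) [Semigroup X] : Cardinal :=
  sInf {c : Cardinal | ∃ C : Set (Set X), (∀ A ∈ C, IsAlgebraicSet A) ∧
    ⋃₀ C = Set.univ ∧ Cardinal.mk ↥C = c}

/-- A subset `S` of a semigroup `X` is polybounded in `X` if it can be covered by
finitely many algebraic subsets of `X`. -/
def PolyboundedIn {X : Type*} [Semigroup X] (S : Set X) : Prop :=
  ∃ C : Set (Set X), C.Finite ∧ (∀ A ∈ C, IsAlgebraicSet A) ∧ S ⊆ ⋃₀ C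

/-- A semigroup is polybounded if it admits a finite cover by algebraic sets. -/
def Polybounded (X : Type*) [Semigroup X] : Prop :=
  PolyboundedIn (Set.univ : Set X)

/-- A semigroup `X` is polyfinite if there are `n ∈ ℕ` and a finite `F ⊆ X` such that
for all `x, y ∈ X` some semigroup polynomial `f` of degree `≤ n` has `f(x), f(y) ∈ F`. -/
def Polyfinite (X : Type*) [Semigroup X] : Prop :=
  ∃ (n : ℕ) (F : Set X), F.Finite ∧ ∀ x y : X, ∃ a : List (WithOne X),
    2 ≤ a.length ∧ a.length ≤ n + 1 ∧
    (∃ u ∈ F, polyVal a x = (u : WithOne X)) ∧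
    (∃ v ∈ F, polyVal a y = (v : WithOne X))

/-- A semigroup `X` is zero-closed if `X` is closed in its `0`-extension
`X⁰ = WithZero X` endowed with any Hausdorff semigroup topology. -/
def ZeroClosed (X : Type*) [Semigroup X] : Prop :=
  ∀ τ : TopologicalSpace (WithZero X),
    @T2Space (WithZero X) τ → @ContinuousMul (WithZero X) τ _ →
    @IsClosed (WithZero X) τ (Set.range ((↑) : X → WithZero X))

/-- `d` is a pseudometric. -/
def IsPseudometric {X : Type*} (d : X → X → ℝ) : Prop :=
  (∀ x, d x x = 0) ∧ (∀ x y, d x y = d y x) ∧ (∀ x y z, d x z ≤ d x y + d y z)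

/-- `d` is subinvariant: `d(axb, ayb) ≤ d(x,y)` for all `a, b ∈ X¹`
(equivalently, `d` is both left- and right-nonexpansive under translations). -/
def Subinvariant {X : Type*} [Semigroup X] (d : X → X → ℝ) : Prop :=
  (∀ a x y : X, d (a * x) (a * y) ≤ d x y) ∧
  (∀ b x y : X, d (x * b) (y * b) ≤ d x y)

/-- `d` is separable: some countable set is `d`-dense. -/
def SeparablePseudometric {X : Type*} (d : X → X → ℝ) : Prop :=
  ∃ C : Set X, C.Countable ∧ ∀ x : X, ∀ ε : ℝ, 0 < ε → ∃ c ∈ C, d x c < ε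

/-- `cov(M)`: the smallest cardinality of a cover of the real line by meager sets. -/
noncomputable def covMeager : Cardinal :=
  sInf {c : Cardinal | ∃ S : Set (Set ℝ), (∀ A ∈ S, IsMeagre A) ∧
    ⋃₀ S = Set.univ ∧ Cardinal.mk ↥S = c}

/-- `cov(N̄)`: the smallest cardinality of a cover of the real line by closed
Lebesgue-null sets. -/
noncomputable def covClosedNull : Cardinal :=
  sInf {c : Cardinal | ∃ S : Set (Set ℝ),
    (∀ A ∈ S, IsClosed A ∧ MeasureTheory.volume A = 0) ∧
    ⋃₀ S = Set.univ ∧ Cardinal.mk ↥S = c}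

/-- A topological space is power-Lindelöf if each finite power is Lindelöf. -/
def PowerLindelof (Y : Type*) [TopologicalSpace Y] : Prop :=
  ∀ n : ℕ, LindelofSpace (Fin n → Y)

/-- `I` is an ideal of the semigroup `X`. -/
def IsIdeal {X : Type*} [Semigroup X] (I : Set X) : Prop :=
  ∀ x ∈ I, ∀ a : X, x * a ∈ I ∧ a * x ∈ I

/-- Formal semigroup polynomials with coefficients in `ι`. -/
inductive Term (ι : Type*) where
  | var : Term ι
  | const : ι → Term ι
  | mul : Term ι → Term ι → Term ι

namespace Term

variable {ι κ X Y : Type*}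

/-- The variable occurs in the polynomial. -/
def HasVar : Term ι → Prop
  | var => True
  | const _ => False
  | mul v w => HasVar v ∨ HasVar w

/-- The number of letters of the polynomial. -/
def size : Term ι → ℕ
  | var => 1
  | const _ => 1
  | mul v w => size v + size w

/-- The set of coefficients of the polynomial. -/
def coeffs : Term ι → Set ι
  | var => ∅
  | const i => {i}
  | mul v w => coeffs v ∪ coeffs w

/-- Substitution of a polynomial for the variable. -/
def subst (u : Term ι) : Term ι → Term ι
  | var => u
  | const i => const i
  | mul v w => mul (subst u v) (subst u w)

/-- Renaming of the coefficients. -/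
def map (f : ι → κ) : Term ι → Term κ
  | var => var
  | const i => const (f i)
  | mul v w => mul (map f v) (map f w)

/-- The value of a polynomial with the coefficients interpreted by `t`. -/
def eval [Mul X] (t : ι → X) (x : X) : Term ι → X
  | var => x
  | const i => t i
  | mul v w => eval t x v * eval t x w

/-- The value at `x` of a polynomial with coefficients in `X`. -/
abbrev ev [Mul X] (x : X) (w : Term X) : X := eval id x w

theorem size_pos (w : Term ι) : 0 < w.size := by
  induction w <;> simp_all [size]

theorem eval_subst [Mul X] (t : ι → X) (x : X) (u w : Term ι) :
    eval t x (subst u w) = eval t (eval t x u) w := by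
  induction w <;> simp_all [subst, eval]

theorem HasVar.subst {u w : Term ι} (hu : u.HasVar) (hw : w.HasVar) :
    (Term.subst u w).HasVar := by
  induction w with
  | var => exact hu
  | const i => exact hw
  | mul v w ihv ihw => exact hw.imp ihv ihw

theorem coeffs_subst_subset (u w : Term ι) : (subst u w).coeffs ⊆ u.coeffs ∪ w.coeffs := by
  induction w with
  | var => simp [subst]
  | const i => simp [subst, coeffs]
  | mul v w ihv ihw =>
    simp only [subst, coeffs, Set.union_subset_iff]
    exact ⟨ihv.trans (by grind), ihw.trans (by grind)⟩

theorem eval_map [Mul X] (f : ι → κ) (t : κ → X) (x : X) (w : Term ι) :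
    eval t x (map f w) = eval (t ∘ f) x w := by
  induction w <;> simp_all [map, eval]

theorem hasVar_map (f : ι → κ) (w : Term ι) : (map f w).HasVar ↔ w.HasVar := by
  induction w <;> simp_all [map, HasVar]

theorem map_eval [Mul X] [Mul Y] (f : X →ₙ* Y) (t : ι → X) (x : X) (w : Term ι) :
    f (eval t x w) = eval (f ∘ t) (f x) w := by
  induction w <;> simp_all [eval]

theorem continuous_ev [Mul X] [TopologicalSpace X] [ContinuousMul X] (w : Term X) :
    Continuous fun x => ev x w := by
  induction w with
  | var => exact continuous_id
  | const i => exact continuous_const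
  | mul v w ihv ihw => exact ihv.mul ihw

/-- Polynomials of nesting depth less than `n` with coefficients in `B`. -/
def level (B : Set ι) : ℕ → Set (Term ι)
  | 0 => ∅
  | n + 1 => {var} ∪ const '' B ∪ Set.image2 mul (level B n) (level B n)

theorem level_mono (B : Set ι) : Monotone (level B) := by
  refine monotone_nat_of_le_succ fun n => ?_
  induction n with
  | zero => exact Set.empty_subset _
  | succ n ih => exact Set.union_subset_union_right _ (Set.image2_subset ih ih)

theorem mem_level_size {B : Set ι} {w : Term ι} (h : w.coeffs ⊆ B) : w ∈ level B w.size := by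
  induction w with
  | var => simp [size, level]
  | const i => simpa [size, level, coeffs] using h
  | mul v w ihv ihw =>
    have hv := v.size_pos
    have hw := w.size_pos
    obtain ⟨k, hk⟩ : ∃ k, (mul v w).size = k + 1 := ⟨v.size + w.size - 1, by simp [size]; omega⟩
    simp only [coeffs, Set.union_subset_iff] at h
    have hk' : v.size + w.size = k + 1 := hk
    rw [hk]
    exact Or.inr ⟨v, level_mono B (by omega) (ihv h.1), w, level_mono B (by omega) (ihw h.2), rfl⟩

theorem finite_level {B : Set ι} (hB : B.Finite) (n : ℕ) : (level B n).Finite := by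
  induction n with
  | zero => exact Set.finite_empty
  | succ n ih =>
    exact ((Set.finite_singleton _).union (hB.image _)).union (ih.image2 _ ih)

theorem finite_size_le {B : Set ι} (hB : B.Finite) (n : ℕ) :
    {w : Term ι | w.coeffs ⊆ B ∧ w.size ≤ n}.Finite :=
  (finite_level hB n).subset fun _ hw => level_mono B hw.2 (mem_level_size hw.1)

theorem mk_coeffs_subset_le {ι : Type u} (B : Set ι) :
    #{w : Term ι | w.coeffs ⊆ B} ≤ max ℵ₀ #B := by
  have hlev : ∀ n, #(level B n) ≤ max ℵ₀ #B := by
    intro n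
    induction n with
    | zero => simp [level]
    | succ n ih =>
      have hc : ℵ₀ ≤ max ℵ₀ #B := le_max_left _ _
      refine (mk_union_le _ _).trans (add_le_of_le hc ((mk_union_le _ _).trans
        (add_le_of_le hc ?_ (mk_image_le.trans (le_max_right _ _)))) ?_)
      · simp only [mk_fintype, Fintype.card_unique, Nat.cast_one]
        exact one_le_aleph0.trans hc
      · rw [← Set.image_prod]
        refine mk_image_le.trans ?_
        rw [mk_setProd]
        simpa using mul_le_of_le hc ih ih
  have hsub : {w : Term ι | w.coeffs ⊆ B} ⊆ ⋃ n : ℕ, level B n := fun w hw =>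
    Set.mem_iUnion.2 ⟨_, mem_level_size hw⟩
  refine (mk_le_mk_of_subset hsub).trans ?_
  have hU := mk_iUnion_le_lift (fun n => level B n)
  rw [lift_uzero] at hU
  refine hU.trans ?_
  rw [mk_nat, lift_aleph0]
  exact mul_le_of_le (le_max_left _ _) (le_max_left _ _) (ciSup_le' fun n => by simpa using hlev n)

instance [Countable ι] : Countable (Term ι) := by
  have h : (Set.univ : Set (Term ι)).Countable := by
    rw [← le_aleph0_iff_set_countable]
    have := mk_coeffs_subset_le (Set.univ : Set ι)
    simpa using this
  exact Set.countable_univ_iff.1 h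

end Term

open Term

section Polynomial

variable {X : Type*} [Semigroup X]

theorem polyVal_cons_of_ne_nil (a₀ : WithOne X) {c : List (WithOne X)} (hc : c ≠ []) (x : X) :
    polyVal (a₀ :: c) x = a₀ * x * polyVal c x := by
  cases c with
  | nil => exact absurd rfl hc
  | cons b c => simp [polyVal, mul_assoc]

theorem exists_polyVal_mul (a b : List (WithOne X)) (ha : a ≠ []) (hb : b ≠ []) :
    ∃ c : List (WithOne X), c.length + 1 = a.length + b.length ∧
      ∀ x, polyVal c x = polyVal a x * polyVal b x := by
  induction a with
  | nil => exact absurd rfl ha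
  | cons a₀ a ih =>
    rcases eq_or_ne a [] with rfl | h
    · cases b with
      | nil => exact absurd rfl hb
      | cons b₀ b => exact ⟨(a₀ * b₀) :: b, by simp; omega, fun x => by simp [polyVal, mul_assoc]⟩
    · obtain ⟨c, hc, hcx⟩ := ih h
      have hb' := List.length_pos_iff.2 hb
      have ha' := List.length_pos_iff.2 h
      refine ⟨a₀ :: c, by simp; omega, fun x => ?_⟩
      rw [polyVal_cons_of_ne_nil _ (List.length_pos_iff.1 (by omega)), hcx,
        polyVal_cons_of_ne_nil _ h, mul_assoc, mul_assoc, mul_assoc]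

theorem Term.exists_polyVal (w : Term X) :
    ∃ a : List (WithOne X), a ≠ [] ∧ (w.HasVar → 2 ≤ a.length) ∧
      ∀ x, polyVal a x = (ev x w : X) := by
  induction w with
  | var => exact ⟨[1, 1], by simp, by simp, fun x => by simp [polyVal, ev, eval]⟩
  | const c =>
    exact ⟨[(c : WithOne X)], by simp, by simp [HasVar], fun x => by simp [polyVal, ev, eval]⟩
  | mul v w ihv ihw =>
    obtain ⟨a, ha, hav, hax⟩ := ihv
    obtain ⟨b, hb, hbv, hbx⟩ := ihw
    obtain ⟨c, hc, hcx⟩ := exists_polyVal_mul a b ha hb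
    have ha' := List.length_pos_iff.2 ha
    have hb' := List.length_pos_iff.2 hb
    refine ⟨c, List.length_pos_iff.1 (by omega), ?_, fun x => ?_⟩
    · rintro (h | h)
      · have := hav h; omega
      · have := hbv h; omega
    · rw [hcx, hax, hbx]; simp [ev, eval]

/-- `C` is covered by finitely many sets of the form `{x | w(x) = b}` with `w` a nonconstant
polynomial. -/
def PolyCovered (C : Set X) : Prop :=
  ∃ E : Set (Term X × X), E.Finite ∧ (∀ p ∈ E, p.1.HasVar) ∧ ∀ x ∈ C, ∃ p ∈ E, ev x p.1 = p.2

theorem PolyCovered.polybounded (h : PolyCovered (Set.univ : Set X)) : Polybounded X := by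
  obtain ⟨E, hE, hv, hc⟩ := h
  refine ⟨(fun p : Term X × X => {x | ev x p.1 = p.2}) '' E, hE.image _, ?_, fun x _ => ?_⟩
  · rintro _ ⟨p, hp, rfl⟩
    obtain ⟨a, -, ha, hax⟩ := p.1.exists_polyVal
    exact ⟨a, p.2, ha (hv p hp), by ext x; simp [hax]⟩
  · obtain ⟨p, hp, hx⟩ := hc x trivial
    exact ⟨_, ⟨p, hp, rfl⟩, hx⟩

theorem PolyCovered.mono {C D : Set X} (h : PolyCovered D) (hCD : C ⊆ D) : PolyCovered C := by
  obtain ⟨E, hE, hv, hc⟩ := h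
  exact ⟨E, hE, hv, fun x hx => hc x (hCD hx)⟩

theorem PolyCovered.preimage {C : Set X} (h : PolyCovered C) {u : Term X} (hu : u.HasVar) :
    PolyCovered {x | ev x u ∈ C} := by
  obtain ⟨E, hE, hv, hc⟩ := h
  refine ⟨(fun p => (subst u p.1, p.2)) '' E, hE.image _, ?_, fun x hx => ?_⟩
  · rintro _ ⟨p, hp, rfl⟩
    exact hu.subst (hv p hp)
  · obtain ⟨p, hp, hxp⟩ := hc _ hx
    exact ⟨_, ⟨p, hp, rfl⟩, by simpa [ev, eval_subst] using hxp⟩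

theorem PolyCovered.empty : PolyCovered (∅ : Set X) :=
  ⟨∅, Set.finite_empty, by simp, by simp⟩

theorem polyCovered_setOf_ev_eq {w : Term X} (hw : w.HasVar) (b : X) :
    PolyCovered {x | ev x w = b} :=
  ⟨{(w, b)}, Set.finite_singleton _, by simpa using hw, by simp⟩

theorem Set.Finite.polyCovered {C : Set X} (hC : C.Finite) : PolyCovered C :=
  ⟨(fun c => (Term.var, c)) '' C, hC.image _, by simp [HasVar], fun x hx =>
    ⟨_, ⟨x, hx, rfl⟩, rfl⟩⟩

theorem PolyCovered.biUnion {ι : Type*} {s : Set ι} (hs : s.Finite) {C : ι → Set X}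
    (h : ∀ i ∈ s, PolyCovered (C i)) : PolyCovered (⋃ i ∈ s, C i) := by
  choose! E hE hv hc using h
  refine ⟨⋃ i ∈ s, E i, hs.biUnion hE, ?_, fun x hx => ?_⟩
  · simp only [Set.mem_iUnion]
    rintro p ⟨i, hi, hp⟩
    exact hv i hi p hp
  · simp only [Set.mem_iUnion] at hx
    obtain ⟨i, hi, hx⟩ := hx
    obtain ⟨p, hp, hxp⟩ := hc i hi x hx
    exact ⟨p, Set.mem_biUnion hi hp, hxp⟩

end Polynomial

/-- Every homomorphic image of `X` in a Tychonoff topological semigroup is closed. -/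
def ClosedImages (X : Type u) [Semigroup X] : Prop :=
  ∀ (Y : Type u) [Semigroup Y] [TopologicalSpace Y],
    ∀ [ContinuousMul Y] [CompletelyRegularSpace Y] [T2Space Y],
    ∀ f : X →ₙ* Y, IsClosed (Set.range f)

open Filter Topology in
theorem ClosedImages.false_of_zero_family {X : Type u} [Semigroup X] (hX : ClosedImages X)
    {ι : Type*} [Nonempty ι] (U : ι → Set X) (hdir : Directed (· ⊇ ·) U)
    (hne : ∀ i, (U i).Nonempty)
    (hmul : ∀ i, ∃ j, ∀ u ∈ U j, ∀ v ∈ U j, u * v ∈ U i)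
    (hleft : ∀ a i, ∃ j, ∀ u ∈ U j, a * u ∈ U i)
    (hright : ∀ a i, ∃ j, ∀ u ∈ U j, u * a ∈ U i)
    (hsep : ∀ b, ∃ i, b ∉ U i) : False := by
  set F : Filter (WithZero X) := map (↑) (⨅ i, 𝓟 (U i)) with hF
  have hFb : F.HasBasis (fun _ : ι => True) fun i => (↑) '' U i :=
    (hasBasis_iInf_principal hdir).map _
  let : TopologicalSpace (WithZero X) := nhdsAdjoint 0 F
  have hn0 : 𝓝 (0 : WithZero X) = pure 0 ⊔ F := nhds_nhdsAdjoint_same 0 F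
  have hnx : ∀ x : X, 𝓝 (x : WithZero X) = pure (x : WithZero X) := fun x =>
    nhds_nhdsAdjoint_of_ne F WithZero.coe_ne_zero
  have hmem0 : ∀ s : Set (WithZero X),
      s ∈ 𝓝 (0 : WithZero X) ↔ 0 ∈ s ∧ ∃ i, ∀ u ∈ U i, (u : WithZero X) ∈ s := by
    intro s
    rw [hn0, mem_sup, mem_pure, hFb.mem_iff]
    simp [Set.subset_def]
  have hopen : ∀ s : Set (WithZero X), 0 ∉ s → IsOpen s := by
    intro s hs
    rw [isOpen_iff_mem_nhds]
    intro y hy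
    induction y with
    | zero => exact absurd hy hs
    | coe y => rw [hnx]; exact hy
  have : T1Space (WithZero X) := by
    refine ⟨fun x => isOpen_compl_iff.1 ?_⟩
    induction x with
    | zero => exact hopen _ (by simp)
    | coe x =>
      rw [isOpen_iff_mem_nhds]
      intro y hy
      induction y with
      | zero =>
        obtain ⟨i, hi⟩ := hsep x
        refine (hmem0 _).2 ⟨hy, i, fun u hu h => hi ?_⟩
        rwa [← WithZero.coe_inj.1 h]
      | coe y => rw [hnx]; exact hy
  have : NormalSpace (WithZero X) := by
    refine ⟨fun s t hs ht hst => ?_⟩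
    by_cases h0 : (0 : WithZero X) ∈ s
    · have h0t : 0 ∉ t := fun h => hst.ne_of_mem h0 h rfl
      exact ⟨tᶜ, t, ht.isOpen_compl, hopen t h0t, hst.subset_compl_right, subset_rfl,
        disjoint_compl_left⟩
    · exact ⟨s, sᶜ, hopen s h0, hs.isOpen_compl, subset_rfl, hst.subset_compl_left,
        disjoint_compl_right⟩
  have : ContinuousMul (WithZero X) := by
    refine ⟨continuous_iff_continuousAt.2 ?_⟩
    rintro ⟨x, y⟩
    rw [ContinuousAt, nhds_prod_eq]
    intro s hs
    rw [mem_map]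
    induction x with
    | zero =>
      simp only [zero_mul, hmem0] at hs
      obtain ⟨h0, i, hi⟩ := hs
      induction y with
      | zero =>
        obtain ⟨j, hj⟩ := hmul i
        have hV : insert 0 ((↑) '' U j) ∈ 𝓝 (0 : WithZero X) :=
          (hmem0 _).2 ⟨Set.mem_insert _ _, j, fun u hu => Or.inr ⟨u, hu, rfl⟩⟩
        filter_upwards [prod_mem_prod hV hV]
        rintro ⟨a, b⟩ ⟨rfl | ⟨a, ha, rfl⟩, rfl | ⟨b, hb, rfl⟩⟩
        · simpa using h0
        · simpa using h0
        · simpa using h0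
        · simpa using hi _ (hj a ha b hb)
      | coe y =>
        obtain ⟨j, hj⟩ := hright y i
        have hV : insert 0 ((↑) '' U j) ∈ 𝓝 (0 : WithZero X) :=
          (hmem0 _).2 ⟨Set.mem_insert _ _, j, fun u hu => Or.inr ⟨u, hu, rfl⟩⟩
        have hW : {(y : WithZero X)} ∈ 𝓝 (y : WithZero X) := by rw [hnx]; exact rfl
        filter_upwards [prod_mem_prod hV hW]
        rintro ⟨a, b⟩ ⟨rfl | ⟨a, ha, rfl⟩, rfl⟩
        · simpa using h0
        · simpa using hi _ (hj a ha)
    | coe x =>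
      have hW : {(x : WithZero X)} ∈ 𝓝 (x : WithZero X) := by rw [hnx]; exact rfl
      induction y with
      | zero =>
        simp only [mul_zero, hmem0] at hs
        obtain ⟨h0, i, hi⟩ := hs
        obtain ⟨j, hj⟩ := hleft x i
        have hV : insert 0 ((↑) '' U j) ∈ 𝓝 (0 : WithZero X) :=
          (hmem0 _).2 ⟨Set.mem_insert _ _, j, fun u hu => Or.inr ⟨u, hu, rfl⟩⟩
        filter_upwards [prod_mem_prod hW hV]
        rintro ⟨a, b⟩ ⟨rfl, rfl | ⟨b, hb, rfl⟩⟩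
        · simpa using h0
        · simpa using hi _ (hj b hb)
      | coe y =>
        have hW' : {(y : WithZero X)} ∈ 𝓝 (y : WithZero X) := by rw [hnx]; exact rfl
        filter_upwards [prod_mem_prod hW hW']
        rintro ⟨a, b⟩ ⟨rfl, rfl⟩
        exact mem_of_mem_nhds (x := (x : WithZero X) * y) hs
  have hcl := hX (WithZero X) ⟨(↑), fun a b => WithZero.coe_mul a b⟩
  have h0 : (0 : WithZero X) ∉ Set.range ((↑) : X → WithZero X) := by simp
  obtain ⟨-, i, hi⟩ := (hmem0 _).1 (hcl.isOpen_compl.mem_nhds h0)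
  obtain ⟨u, hu⟩ := hne i
  exact hi u hu ⟨u, rfl⟩

theorem ClosedImages.of_surjective {X Y : Type u} [Semigroup X] [Semigroup Y]
    (hX : ClosedImages X) (π : X →ₙ* Y) (hπ : Function.Surjective π) : ClosedImages Y := by
  intro Z _ _ _ _ _ f
  have := hX Z (f.comp π)
  rwa [MulHom.coe_comp, hπ.range_comp] at this

section Category

/-- The half-open dyadic interval `[j / 2 ^ n, (j + 1) / 2 ^ n)`. -/
def dyadic (n : ℕ) (j : ℤ) : Set ℝ := {x | ⌊2 ^ n * x⌋ = j}

theorem floor_two_pow_succ_div (n : ℕ) (x : ℝ) : ⌊2 ^ (n + 1) * x⌋ / 2 = ⌊2 ^ n * x⌋ := by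
  have h := Int.floor_div_natCast ((2 : ℝ) ^ (n + 1) * x) 2
  rw [show ((2 : ℕ) : ℤ) = 2 by rfl] at h
  rw [← h]
  congr 1
  push_cast
  ring

theorem dyadic_succ_subset {n : ℕ} {j j' : ℤ} (h : j' / 2 = j) :
    dyadic (n + 1) j' ⊆ dyadic n j := by
  rintro x hx
  have hx' : ⌊2 ^ (n + 1) * x⌋ = j' := hx
  rw [dyadic, Set.mem_ofPred_eq, ← floor_two_pow_succ_div, hx', h]

theorem exists_isOpen_subset_dyadic (n : ℕ) (j : ℤ) :
    ∃ W ⊆ dyadic n j, IsOpen W ∧ W.Nonempty := by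
  have hpos : (0 : ℝ) < 2 ^ n := by positivity
  refine ⟨Set.Ioo (j / 2 ^ n) ((j + 1) / 2 ^ n), fun x hx => ?_, isOpen_Ioo,
    Set.nonempty_Ioo.2 (by gcongr; linarith)⟩
  rw [dyadic, Set.mem_ofPred_eq, Int.floor_eq_iff, mul_comm]
  exact ⟨((div_lt_iff₀ hpos).1 hx.1).le, (lt_div_iff₀ hpos).1 hx.2⟩

theorem exists_dyadic_subset {V : Set ℝ} (hV : IsOpen V) (hne : V.Nonempty) :
    ∃ n j, dyadic n j ⊆ V := by
  obtain ⟨x, hx⟩ := hne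
  obtain ⟨ε, hε, hb⟩ := Metric.isOpen_iff.1 hV x hx
  obtain ⟨n, hn⟩ := exists_pow_lt_of_lt_one hε (by norm_num : (1 / 2 : ℝ) < 1)
  refine ⟨n, ⌊2 ^ n * x⌋, fun y hy => hb ?_⟩
  have hy' : ⌊2 ^ n * y⌋ = ⌊2 ^ n * x⌋ := hy
  have h := Int.abs_sub_lt_one_of_floor_eq_floor hy'
  rw [← mul_sub, abs_mul, abs_of_pos (by positivity : (0 : ℝ) < 2 ^ n)] at h
  rw [Metric.mem_ball, Real.dist_eq]
  have hp : (0 : ℝ) < 2 ^ n := by positivity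
  rw [one_div, inv_pow, ← one_div] at hn
  refine lt_trans ?_ hn
  rwa [lt_div_iff₀ hp, mul_comm]

variable {Y : Type u} [MetricSpace Y]

open Classical in
/-- A walk along the points of a sequence `D`, guided by binary digits: at time `n`, if the last
digit of `j` is one, it moves to the point with the index coded by `n` whenever this point is
closer than the current radius `2⁻ᵏ`, and halves the radius. -/
noncomputable def walk (D : ℕ → Y) : ℕ → ℤ → ℕ × Y
  | 0, _ => (0, D 0)
  | n + 1, j =>
    if Odd j ∧ dist (walk D n (j / 2)).2 (D n.unpair.1) < (1 / 2) ^ (walk D n (j / 2)).1 then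
      ((walk D n (j / 2)).1 + 1, D n.unpair.1)
    else walk D n (j / 2)

/-- The walk guided by the binary digits of a real number. -/
noncomputable def realWalk (D : ℕ → Y) (x : ℝ) (n : ℕ) : ℕ × Y := walk D n ⌊2 ^ n * x⌋

/-- The remaining distance that the walk can travel. -/
noncomputable def walkRange (D : ℕ → Y) (x : ℝ) (n : ℕ) : ℝ := 2 * (1 / 2) ^ (realWalk D x n).1

theorem walk_extend (D : ℕ → Y) {n m : ℕ} (hnm : n ≤ m) (j : ℤ) :
    ∃ j', dyadic m j' ⊆ dyadic n j ∧ walk D m j' = walk D n j := by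
  induction m, hnm using Nat.le_induction with
  | base => exact ⟨j, subset_rfl, rfl⟩
  | succ m _ ih =>
    obtain ⟨j', hj', hw⟩ := ih
    have hd : 2 * j' / 2 = j' := by omega
    refine ⟨2 * j', (dyadic_succ_subset hd).trans hj', ?_⟩
    rw [walk, if_neg, hd, hw]
    rintro ⟨ho, -⟩
    rw [Int.odd_iff] at ho
    omega

theorem walk_move (D : ℕ → Y) {n : ℕ} {j : ℤ} {i : ℕ}
    (hi : dist (walk D n j).2 (D i) < (1 / 2) ^ (walk D n j).1) :
    ∃ n' j', dyadic n' j' ⊆ dyadic n j ∧ walk D n' j' = ((walk D n j).1 + 1, D i) := by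
  obtain ⟨j', hj', hw⟩ := walk_extend D (Nat.right_le_pair i n) j
  have hd : (2 * j' + 1) / 2 = j' := by omega
  refine ⟨Nat.pair i n + 1, 2 * j' + 1, (dyadic_succ_subset hd).trans hj', ?_⟩
  rw [walk, hd, hw, Nat.unpair_pair, if_pos]
  exact ⟨⟨j', rfl⟩, hi⟩

theorem walk_stay (D : ℕ → Y) {n : ℕ} {j : ℤ} {k i : ℕ} (h : walk D n j = (k, D i)) (m : ℕ) :
    ∃ n' j', dyadic n' j' ⊆ dyadic n j ∧ walk D n' j' = (k + m, D i) := by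
  induction m with
  | zero => exact ⟨n, j, subset_rfl, h⟩
  | succ m ih =>
    obtain ⟨n', j', hs, hw⟩ := ih
    obtain ⟨n'', j'', hs', hw'⟩ := walk_move D (n := n') (j := j') (i := i) (by rw [hw]; simp)
    exact ⟨n'', j'', hs'.trans hs, by rw [hw', hw]; rfl⟩

theorem dist_realWalk_succ (D : ℕ → Y) (x : ℝ) (n : ℕ) :
    dist (realWalk D x n).2 (realWalk D x (n + 1)).2 ≤ walkRange D x n - walkRange D x (n + 1) := by
  simp only [walkRange, realWalk, walk, floor_two_pow_succ_div]
  split_ifs with h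
  · refine h.2.le.trans (le_of_eq ?_)
    rw [pow_succ]
    ring
  · simp

theorem dist_realWalk (D : ℕ → Y) (x : ℝ) {n m : ℕ} (hnm : n ≤ m) :
    dist (realWalk D x n).2 (realWalk D x m).2 ≤ walkRange D x n - walkRange D x m := by
  induction m, hnm using Nat.le_induction with
  | base => simp
  | succ m _ ih =>
    linarith [dist_triangle (realWalk D x n).2 (realWalk D x m).2 (realWalk D x (m + 1)).2,
      dist_realWalk_succ D x m]

theorem walkRange_pos (D : ℕ → Y) (x : ℝ) (n : ℕ) : 0 < walkRange D x n := by
  unfold walkRange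
  positivity

theorem cauchySeq_realWalk (D : ℕ → Y) (x : ℝ) : CauchySeq fun n => (realWalk D x n).2 := by
  have hanti : Antitone (walkRange D x) := fun n m h => by
    linarith [dist_realWalk D x h, dist_nonneg (x := (realWalk D x n).2) (y := (realWalk D x m).2)]
  have hc : CauchySeq (walkRange D x) :=
    (tendsto_atTop_ciInf hanti ⟨0, by rintro _ ⟨n, rfl⟩; exact (walkRange_pos D x n).le⟩).cauchySeq
  rw [Metric.cauchySeq_iff'] at hc ⊢
  intro ε hε
  obtain ⟨N, hN⟩ := hc ε hε
  refine ⟨N, fun n hn => ?_⟩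
  have h1 := hN n hn
  rw [Real.dist_eq, abs_lt] at h1
  rw [dist_comm]
  linarith [dist_realWalk D x hn]

theorem exists_realMap [CompleteSpace Y] (D : ℕ → Y) :
    ∃ φ : ℝ → Y, ∀ x n, dist (realWalk D x n).2 (φ x) ≤ walkRange D x n := by
  choose φ hφ using fun x => cauchySeq_tendsto_of_complete (cauchySeq_realWalk D x)
  refine ⟨φ, fun x n => le_of_tendsto (tendsto_const_nhds.dist (hφ x)) ?_⟩
  filter_upwards [Filter.eventually_ge_atTop n] with m hm
  linarith [dist_realWalk D x hm, walkRange_pos D x m]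

theorem isNowhereDense_preimage {D : ℕ → Y} (hD : DenseRange D) {φ : ℝ → Y}
    (hφ : ∀ x n, dist (realWalk D x n).2 (φ x) ≤ walkRange D x n) {A : Set Y} (hA : IsClosed A)
    (h_interior : interior A = ∅) : IsNowhereDense (φ ⁻¹' A) := by
  have key : ∀ n j, ∃ n' j', dyadic n' j' ⊆ dyadic n j ∧ ∀ x ∈ dyadic n' j', φ x ∉ A := by
    intro n j
    set k := (walk D n j).1
    set p := (walk D n j).2
    have hne : (Metric.ball p ((1 / 2) ^ k) ∩ Aᶜ).Nonempty := by
      rw [← Set.sdiff_eq, Set.sdiff_nonempty]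
      intro hsub
      have : p ∈ interior A := interior_maximal hsub Metric.isOpen_ball
        (Metric.mem_ball_self (by positivity))
      rw [h_interior] at this
      exact this
    obtain ⟨i, hi, hiA⟩ := hD.exists_mem_open (Metric.isOpen_ball.inter hA.isOpen_compl) hne
    rw [Metric.mem_ball, dist_comm] at hi
    obtain ⟨δ, hδ, hball⟩ := Metric.isOpen_iff.1 hA.isOpen_compl _ hiA
    obtain ⟨m, hm⟩ := exists_pow_lt_of_lt_one (half_pos hδ) (by norm_num : (1 / 2 : ℝ) < 1)
    obtain ⟨n₁, j₁, hs₁, hw₁⟩ := walk_move D hi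
    obtain ⟨n₂, j₂, hs₂, hw₂⟩ := walk_stay D hw₁ m
    refine ⟨n₂, j₂, hs₂.trans hs₁, fun x hx => hball ?_⟩
    have hx' : ⌊2 ^ n₂ * x⌋ = j₂ := hx
    have hle := hφ x n₂
    simp only [walkRange, realWalk, hx', hw₂] at hle
    rw [Metric.mem_ball, dist_comm]
    have hpow : (1 / 2 : ℝ) ^ ((walk D n j).1 + 1 + m) ≤ (1 / 2) ^ m :=
      pow_le_pow_of_le_one (by norm_num) (by norm_num) (by omega)
    linarith
  rw [IsNowhereDense, Set.eq_empty_iff_forall_notMem]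
  intro x hx
  obtain ⟨n, j, hnj⟩ := exists_dyadic_subset isOpen_interior ⟨x, hx⟩
  obtain ⟨n', j', hs, hA'⟩ := key n j
  obtain ⟨W, hW, hWo, y, hy⟩ := exists_isOpen_subset_dyadic n' j'
  obtain ⟨z, hz, hzA⟩ := mem_closure_iff.1 (interior_subset (hnj (hs (hW hy)))) W hWo hy
  exact hA' z (hW hz) hzA

theorem exists_forall_notMem_of_lt_covMeager [CompleteSpace Y] [TopologicalSpace.SeparableSpace Y]
    [Nonempty Y] {I : Type u} (A : I → Set Y) (hA : ∀ i, IsClosed (A i))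
    (h_interior : ∀ i, interior (A i) = ∅) (hI : #I < lift.{u} covMeager) : ∃ y, ∀ i, y ∉ A i := by
  obtain ⟨D, hD⟩ := TopologicalSpace.exists_dense_seq Y
  obtain ⟨φ, hφ⟩ := exists_realMap D
  by_contra! hcon
  refine hI.not_ge ?_
  have hle : covMeager ≤ #(Set.range fun i => φ ⁻¹' A i) := by
    refine csInf_le' ⟨_, ?_, ?_, rfl⟩
    · rintro _ ⟨i, rfl⟩
      exact (isNowhereDense_preimage hD hφ (hA i) (h_interior i)).isMeagre
    · refine Set.eq_univ_of_forall fun x => ?_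
      obtain ⟨i, hi⟩ := hcon (φ x)
      exact ⟨_, ⟨i, rfl⟩, hi⟩
  refine (lift_le.2 hle).trans ?_
  simpa using mk_range_le_lift (f := fun i => φ ⁻¹' A i)

end Category

section Completeness

theorem Subinvariant.dist_mul_le {Q : Type*} [Semigroup Q] [PseudoMetricSpace Q]
    (hd : Subinvariant (dist : Q → Q → ℝ)) (a b a' b' : Q) :
    dist (a * b) (a' * b') ≤ dist a a' + dist b b' :=
  (dist_triangle _ (a' * b) _).trans (add_le_add (hd.2 _ _ _) (hd.1 _ _ _))

theorem Subinvariant.uniformContinuous_mul {Q : Type*} [Semigroup Q] [PseudoMetricSpace Q]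
    (hd : Subinvariant (dist : Q → Q → ℝ)) : UniformContinuous₂ fun a b : Q => a * b := by
  rw [UniformContinuous₂, Metric.uniformContinuous_iff]
  refine fun ε hε => ⟨ε / 2, half_pos hε, fun {p q} h => ?_⟩
  rw [Prod.dist_eq, max_lt_iff] at h
  have := hd.dist_mul_le p.1 p.2 q.1 q.2
  simp only [Function.uncurry_def]
  linarith [h.1, h.2]

theorem Subinvariant.continuousMul {Q : Type*} [Semigroup Q] [PseudoMetricSpace Q]
    (hd : Subinvariant (dist : Q → Q → ℝ)) : ContinuousMul Q :=
  ⟨hd.uniformContinuous_mul.continuous⟩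

open UniformSpace in
theorem ClosedImages.completeSpace {Q : Type u} [Semigroup Q] [MetricSpace Q]
    (hQ : ClosedImages Q) (hd : Subinvariant (dist : Q → Q → ℝ)) : CompleteSpace Q := by
  have hu := hd.uniformContinuous_mul
  let M : Completion Q → Completion Q → Completion Q := Completion.map₂ fun a b => a * b
  have hM : Continuous fun p : Completion Q × Completion Q => M p.1 p.2 :=
    (Completion.uniformContinuous_map₂ _).continuous
  have hMc : ∀ a b : Q, M a b = ((a * b : Q) : Completion Q) := fun a b =>
    Completion.map₂_coe_coe a b _ hu
  let : Semigroup (Completion Q) :=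
    { mul := M
      mul_assoc := fun a b c => by
        change M (M a b) c = M a (M b c)
        refine Completion.induction_on₃ a b c (isClosed_eq ?_ ?_) fun x y z => ?_
        · fun_prop
        · fun_prop
        · rw [hMc, hMc, hMc, hMc, mul_assoc] }
  have : ContinuousMul (Completion Q) := ⟨hM⟩
  have hcl := hQ (Completion Q) ⟨(↑), fun a b => (hMc a b).symm⟩
  have huniv : Set.range ((↑) : Q → Completion Q) = Set.univ :=
    hcl.closure_eq.symm.trans Completion.denseRange_coe.closure_range
  have hi : IsUniformInducing ((↑) : Q → Completion Q) := Completion.isUniformInducing_coe Q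
  refine (completeSpace_iff_isComplete_range hi).2 ?_
  rw [huniv]
  exact isComplete_univ

end Completeness

section Nonmeager

theorem exists_rec_of_forall_exists {ι : Type*} {α : Type*} [Preorder ι] [WellFoundedLT ι]
    (P : (x : ι) → (Set.Iio x → α) → α → Prop) (h : ∀ x g, ∃ a, P x g a) :
    ∃ z : ι → α, ∀ x, P x (fun y => z y) (z x) := by
  choose f hf using h
  refine ⟨wellFounded_lt.fix fun x ih => f x fun y => ih y.1 y.2, fun x => ?_⟩
  rw [WellFounded.fix_eq]
  exact hf _ _

theorem mk_le_continuum_of_separableSpace (Q : Type u) [MetricSpace Q]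
    [TopologicalSpace.SeparableSpace Q] : #Q ≤ continuum := by
  rcases isEmpty_or_nonempty Q with h | h
  · simp
  obtain ⟨D, hD⟩ := TopologicalSpace.exists_dense_seq Q
  have hinj : Function.Injective fun (x : Q) (n : ℕ) => dist x (D n) := by
    intro x y hxy
    refine eq_of_forall_dist_le fun ε hε => ?_
    obtain ⟨n, hn⟩ := hD.exists_dist_lt x (half_pos hε)
    have h1 : dist x (D n) = dist y (D n) := congrFun hxy n
    linarith [dist_triangle_right x y (D n)]
  have := lift_mk_le_lift_mk_of_injective hinj
  simpa [mk_real] using this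

variable {Q : Type u} [Semigroup Q] [MetricSpace Q]

theorem exists_mem_forall_ev_ne [TopologicalSpace.SeparableSpace Q] [CompleteSpace Q]
    [ContinuousMul Q] (hcov : covMeager = continuum) {J : Set Q} (hJc : IsClosed J)
    (hJne : J.Nonempty) (hJ : ∀ O, IsOpen O → (O ∩ J).Nonempty → ¬ PolyCovered (O ∩ J))
    {B : Set Q} (hB : #B < continuum) :
    ∃ z ∈ J, ∀ w : Term Q, w.HasVar → w.coeffs ⊆ B → ev z w ∉ B := by
  have := hJc.completeSpace_coe
  have := hJne.to_subtype
  have := UniformSpace.secondCountable_of_separable Q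
  let I : Set (Term Q × Q) := {p | p.1.HasVar ∧ p.1.coeffs ⊆ B ∧ p.2 ∈ B}
  have hI : #I < lift.{u} covMeager := by
    rw [hcov, lift_continuum]
    have hsub : I ⊆ {w : Term Q | w.coeffs ⊆ B} ×ˢ B := fun p hp => hp.2
    refine (mk_le_mk_of_subset hsub).trans_lt ?_
    rw [mk_setProd]
    refine mul_lt_of_lt aleph0_le_continuum ((mk_coeffs_subset_le B).trans_lt ?_) hB
    exact max_lt aleph0_lt_continuum hB
  obtain ⟨z, hz⟩ := exists_forall_notMem_of_lt_covMeager (Y := J)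
    (fun p : I => {x : J | ev (x : Q) p.1.1 = p.1.2})
    (fun p => isClosed_eq ((continuous_ev p.1.1).comp continuous_subtype_val) continuous_const)
    (fun p => by
      rw [Set.eq_empty_iff_forall_notMem]
      intro x hx
      obtain ⟨O, hO, hOi⟩ := isOpen_induced_iff.1
        (isOpen_interior (s := {x : J | ev (x : Q) p.1.1 = p.1.2}))
      refine hJ O hO ⟨x, by rw [← hOi] at hx; exact hx, x.2⟩
        ((polyCovered_setOf_ev_eq p.2.1 p.1.2).mono fun y hy => ?_)
      have hy' : (⟨y, hy.2⟩ : J) ∈ interior {x : J | ev (x : Q) p.1.1 = p.1.2} := by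
        rw [← hOi]; exact hy.1
      exact interior_subset (s := {x : J | ev (x : Q) p.1.1 = p.1.2}) hy') hI
  exact ⟨z, z.2, fun w hw hwB hb => hz ⟨(w, ev (z : Q) w), hw, hwB, hb⟩ rfl⟩

theorem ClosedImages.false_of_nowhere_polyCovered [TopologicalSpace.SeparableSpace Q]
    [CompleteSpace Q] [ContinuousMul Q] (hQ : ClosedImages Q) (hcov : covMeager = continuum)
    {J : Set Q} (hJc : IsClosed J) (hJne : J.Nonempty)
    (hJ : ∀ O, IsOpen O → (O ∩ J).Nonempty → ¬ PolyCovered (O ∩ J)) : False := by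
  have hinf : Infinite Q := by
    by_contra hfin
    rw [not_infinite_iff_finite] at hfin
    exact hJ Set.univ isOpen_univ (by simpa using hJne) (Set.Finite.polyCovered (Set.toFinite _))
  let ι := (#Q).ord.ToType
  have : NoMaxOrder ι := Cardinal.noMaxOrder (aleph0_le_mk Q)
  obtain ⟨e⟩ : Nonempty (ι ≃ Q) := Cardinal.eq.1 (by simp [ι])
  let B : (x : ι) → (Set.Iio x → Q) → Set Q := fun x g =>
    Set.range (fun y : Set.Iio x => e y) ∪ Set.range g
  have hBcard : ∀ x g, #(B x g) < continuum := by
    intro x g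
    have hx : #(Set.Iio x) < continuum :=
      lt_of_lt_of_le ((mk_Iio_lt x (by simp [ι])).trans_le (by simp [ι]))
        (mk_le_continuum_of_separableSpace Q)
    exact (mk_union_le _ _).trans_lt (add_lt_of_lt aleph0_le_continuum
      (mk_range_le.trans_lt hx) (mk_range_le.trans_lt hx))
  obtain ⟨z, hz⟩ := exists_rec_of_forall_exists
    (fun x g a => ∀ w : Term Q, w.HasVar → w.coeffs ⊆ B x g → ev a w ∉ B x g) fun x g => by
      obtain ⟨z, -, hz⟩ := exists_mem_forall_ev_ne hcov hJc hJne hJ (hBcard x g)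
      exact ⟨z, hz⟩
  let C : ι → Set Q := fun x => B x fun y => z y
  have heC : ∀ {x y}, y < x → e y ∈ C x := fun {x y} h => Or.inl ⟨⟨y, h⟩, rfl⟩
  have hzC : ∀ {x y}, y < x → z y ∈ C x := fun {x y} h => Or.inr ⟨⟨y, h⟩, rfl⟩
  have hCmono : Monotone C := by
    rintro x x' hx _ (⟨y, rfl⟩ | ⟨y, rfl⟩)
    · exact heC (y.2.trans_le hx)
    · exact hzC (y.2.trans_le hx)
  have hlift : ∀ {y y'} (w : Term Q), y ≤ y' → w.coeffs ⊆ C y →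
      ∃ w' : Term Q, w'.coeffs ⊆ C y' ∧ ev (z y') w' = ev (z y) w := by
    intro y y' w h hw
    rcases h.eq_or_lt with rfl | h
    · exact ⟨w, hw, rfl⟩
    · refine ⟨subst (const (z y)) w, ?_, by simp [eval_subst, eval]⟩
      refine (coeffs_subst_subset _ _).trans (Set.union_subset ?_ (hw.trans (hCmono h.le)))
      simpa [coeffs] using hzC h
  let U : ι → Set Q := fun x =>
    {v | ∃ y ≥ x, ∃ w : Term Q, w.HasVar ∧ w.coeffs ⊆ C y ∧ ev (z y) w = v}
  have hUanti : Antitone U := by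
    rintro x x' hx v ⟨y, hy, h⟩
    exact ⟨y, hx.trans hy, h⟩
  have : Nonempty ι := ⟨e.symm hJne.some⟩
  refine hQ.false_of_zero_family U hUanti.directed_ge
    (fun x => ⟨z x, x, le_rfl, var, trivial, by simp [coeffs], rfl⟩) (fun x => ⟨x, ?_⟩)
    (fun a x => ?_) (fun a x => ?_) (fun b => ?_)
  · rintro _ ⟨y, hy, w, hw, hwC, rfl⟩ _ ⟨y', hy', w', hw', hwC', rfl⟩
    rcases le_total y y' with h | h
    · obtain ⟨v, hv, hve⟩ := hlift w h hwC
      exact ⟨y', hy', mul v w', Or.inr hw', Set.union_subset hv hwC', by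
        rw [← hve]; rfl⟩
    · obtain ⟨v, hv, hve⟩ := hlift w' h hwC'
      exact ⟨y, hy, mul w v, Or.inl hw, Set.union_subset hwC hv, by
        rw [← hve]; rfl⟩
  · obtain ⟨k, rfl⟩ := e.surjective a
    obtain ⟨l, hl⟩ := exists_gt k
    refine ⟨max x l, ?_⟩
    rintro _ ⟨y, hy, w, hw, hwC, rfl⟩
    have hk : e k ∈ C y := heC (hl.trans_le ((le_max_right _ _).trans hy))
    exact ⟨y, (le_max_left _ _).trans hy, mul (const (e k)) w, Or.inr hw,
      Set.union_subset (by simpa [coeffs] using hk) hwC, rfl⟩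
  · obtain ⟨k, rfl⟩ := e.surjective a
    obtain ⟨l, hl⟩ := exists_gt k
    refine ⟨max x l, ?_⟩
    rintro _ ⟨y, hy, w, hw, hwC, rfl⟩
    have hk : e k ∈ C y := heC (hl.trans_le ((le_max_right _ _).trans hy))
    exact ⟨y, (le_max_left _ _).trans hy, mul w (const (e k)), Or.inl hw,
      Set.union_subset hwC (by simpa [coeffs] using hk), rfl⟩
  · obtain ⟨k, rfl⟩ := e.surjective b
    obtain ⟨l, hl⟩ := exists_gt k
    refine ⟨l, ?_⟩
    rintro ⟨y, hy, w, hw, hwC, h⟩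
    exact hz y w hw hwC (h ▸ heC (hl.trans_le hy))

end Nonmeager

section Meager

variable {Q : Type u} [Semigroup Q]

theorem IsIdeal.ev_mem {J : Set Q} (hJ : IsIdeal J) {z : Q} (hz : z ∈ J) {w : Term Q}
    (hw : w.HasVar) : ev z w ∈ J := by
  induction w with
  | var => exact hz
  | const c => exact hw.elim
  | mul v w ihv ihw =>
    rcases hw with h | h
    · exact (hJ _ (ihv h) _).1
    · exact (hJ _ (ihw h) _).2

theorem exists_mem_forall_ev_notMem {J : Set Q} (hJ : ¬ PolyCovered J) {P : ℕ → Set Q}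
    (hP : ∀ n, PolyCovered (P n)) {G : Set Q} (hG : G.Finite) (m : ℕ) :
    ∃ z ∈ J, ∀ w : Term Q, w.HasVar → w.coeffs ⊆ G → w.size ≤ m → ∀ i ≤ m, ev z w ∉ P i := by
  by_contra! hcon
  have hfin : {w : Term Q | w.HasVar ∧ w.coeffs ⊆ G ∧ w.size ≤ m}.Finite :=
    (finite_size_le hG m).subset fun w hw => hw.2
  refine hJ (PolyCovered.mono (PolyCovered.biUnion hfin fun w hw =>
    (PolyCovered.biUnion (Set.finite_Iic m) fun i _ => hP i).preimage hw.1) fun x hx => ?_)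
  obtain ⟨w, hv, hc, hs, i, hi, hmem⟩ := hcon x hx
  exact Set.mem_biUnion (show w ∈ {w : Term Q | w.HasVar ∧ w.coeffs ⊆ G ∧ w.size ≤ m} from
    ⟨hv, hc, hs⟩) (Set.mem_biUnion (Set.mem_Iic.2 hi) hmem)

/-- `Approx G z r v w s`: the element `v` is obtained from the word `w(z)` with coefficients in
`G` by moving these coefficients by a total distance at most `s`, where each letter of the word
contributes at least `r` to `s`. -/
inductive Approx [Dist Q] (G : Set Q) (z : Q) (r : ℝ) : Q → Term Q → ℝ → Prop
  | const {a g : Q} {s : ℝ} (hg : g ∈ G) (hs : dist a g ≤ s) (hr : r ≤ s) :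
      Approx G z r a (const g) s
  | var {s : ℝ} (hr : r ≤ s) : Approx G z r z var s
  | mul {a b : Q} {v w : Term Q} {s t : ℝ} (hv : Approx G z r a v s) (hw : Approx G z r b w t) :
      Approx G z r (a * b) (mul v w) (s + t)

variable [MetricSpace Q] {G G' : Set Q} {z : Q} {r r' : ℝ} {v : Q} {w : Term Q} {s : ℝ}

theorem Approx.dist_le (hd : Subinvariant (dist : Q → Q → ℝ)) (hr : 0 ≤ r)
    (h : Approx G z r v w s) : dist v (ev z w) ≤ s := by
  induction h with
  | const _ hs _ => exact hs
  | var hs => simpa [ev, eval] using hr.trans hs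
  | mul _ _ ihv ihw => exact (hd.dist_mul_le _ _ _ _).trans (add_le_add ihv ihw)

theorem Approx.size_le (h : Approx G z r v w s) : w.size * r ≤ s := by
  induction h with
  | const _ _ hr => simpa [size] using hr
  | var hr => simpa [size] using hr
  | mul _ _ ihv ihw =>
    simp only [size, Nat.cast_add, add_mul]
    exact add_le_add ihv ihw

theorem Approx.coeffs_subset (h : Approx G z r v w s) : w.coeffs ⊆ G := by
  induction h with
  | const hg _ _ => simpa [coeffs] using hg
  | var _ => simp [coeffs]
  | mul _ _ ihv ihw => exact Set.union_subset ihv ihw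

theorem Approx.mem_of_hasVar {J : Set Q} (hJ : IsIdeal J) (hz : z ∈ J) (h : Approx G z r v w s)
    (hw : w.HasVar) : v ∈ J := by
  induction h with
  | const _ _ _ => exact hw.elim
  | var _ => exact hz
  | mul _ _ ihv ihw =>
    rcases hw with h | h
    · exact (hJ _ (ihv h) _).1
    · exact (hJ _ (ihw h) _).2

theorem Approx.change (h : Approx G z r v w s) (hG : G ⊆ G') (hz : z ∈ G') (hr' : r' ≤ r)
    (hr : 0 ≤ r) (z' : Q) : ∃ w', Approx G' z' r' v w' s := by
  induction h with
  | const hg hs hrs => exact ⟨_, .const (hG hg) hs (hr'.trans hrs)⟩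
  | var hrs => exact ⟨_, .const hz (by simpa using hr.trans hrs) (hr'.trans hrs)⟩
  | mul _ _ ihv ihw =>
    obtain ⟨v', hv⟩ := ihv
    obtain ⟨w', hw⟩ := ihw
    exact ⟨_, .mul hv hw⟩

theorem exists_polyCovered_seq [TopologicalSpace.SeparableSpace Q] {J : Set Q} (hJne : J.Nonempty)
    (hloc : ∀ x ∈ J, ∃ O, IsOpen O ∧ x ∈ O ∧ PolyCovered (O ∩ J)) :
    ∃ P : ℕ → Set Q, (∀ n, PolyCovered (P n)) ∧
      ∀ x ∈ J, ∃ n, ∃ δ > 0, ∀ y ∈ J, dist x y < δ → y ∈ P n := by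
  classical
  have : Nonempty Q := ⟨hJne.some⟩
  obtain ⟨D, hD⟩ := TopologicalSpace.exists_dense_seq Q
  let A : ℕ → Set Q := fun n =>
    Metric.ball (D n.unpair.1) (2 * (1 / ((n.unpair.2 : ℝ) + 1))) ∩ J
  refine ⟨fun n => if PolyCovered (A n) then A n else ∅, fun n => ?_, fun x hx => ?_⟩
  · dsimp only
    split_ifs with h
    · exact h
    · exact PolyCovered.empty
  · obtain ⟨O, hO, hxO, hOJ⟩ := hloc x hx
    obtain ⟨ε, hε, hball⟩ := Metric.isOpen_iff.1 hO x hxO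
    obtain ⟨k, hk⟩ := exists_nat_one_div_lt (show 0 < ε / 3 by positivity)
    have hpos : 0 < 1 / ((k : ℝ) + 1) := by positivity
    obtain ⟨i, hi⟩ := hD.exists_dist_lt x hpos
    have hA : PolyCovered (A (Nat.pair i k)) := by
      refine hOJ.mono fun y hy => ⟨hball ?_, hy.2⟩
      have hy1 := hy.1
      simp only [Nat.unpair_pair, Metric.mem_ball] at hy1 ⊢
      linarith [dist_triangle_right y x (D i)]
    refine ⟨Nat.pair i k, _, hpos, fun y hy hxy => ?_⟩
    dsimp only
    rw [if_pos hA]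
    refine ⟨?_, hy⟩
    simp only [Nat.unpair_pair, Metric.mem_ball]
    linarith [dist_triangle_left y (D i) x]

theorem ClosedImages.false_of_locally_polyCovered [TopologicalSpace.SeparableSpace Q]
    (hQ : ClosedImages Q) (hd : Subinvariant (dist : Q → Q → ℝ)) {J : Set Q} (hJi : IsIdeal J)
    (hJ : ¬ PolyCovered J) (hloc : ∀ x ∈ J, ∃ O, IsOpen O ∧ x ∈ O ∧ PolyCovered (O ∩ J)) :
    False := by
  have hJne : J.Nonempty := by
    rw [Set.nonempty_iff_ne_empty]
    rintro rfl
    exact hJ PolyCovered.empty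
  have : Nonempty Q := ⟨hJne.some⟩
  obtain ⟨P, hP, hPloc⟩ := exists_polyCovered_seq hJne hloc
  obtain ⟨D, hD⟩ := TopologicalSpace.exists_dense_seq Q
  obtain ⟨z, hz⟩ := exists_rec_of_forall_exists (ι := ℕ)
    (fun m (g : Set.Iio m → Q) a => a ∈ J ∧ ∀ w : Term Q, w.HasVar →
      w.coeffs ⊆ D '' Set.Iic m ∪ Set.range g → w.size ≤ m + 1 → ∀ i ≤ m + 1, ev a w ∉ P i)
    fun m g => exists_mem_forall_ev_notMem hJ hP
      (((Set.finite_Iic m).image D).union (Set.finite_range g)) (m + 1)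
  let G : ℕ → Set Q := fun m => D '' Set.Iic m ∪ Set.range fun y : Set.Iio m => z y
  have hDG : ∀ {i m}, i ≤ m → D i ∈ G m := fun {i m} h => Or.inl ⟨i, h, rfl⟩
  have hzG : ∀ {i m}, i < m → z i ∈ G m := fun {i m} h => Or.inr ⟨⟨i, h⟩, rfl⟩
  have hGmono : Monotone G := by
    rintro m m' h _ (⟨i, hi, rfl⟩ | ⟨i, rfl⟩)
    · exact hDG (hi.trans h)
    · exact hzG (i.2.trans_le h)
  let r : ℕ → ℝ := fun m => 1 / ((m : ℝ) + 1)
  have hr0 : ∀ m, 0 < r m := fun m => by positivity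
  have hranti : Antitone r := fun m n h => one_div_le_one_div_of_le (by positivity) (by gcongr)
  have hr2 : ∀ n, r (2 * n + 1) + r (2 * n + 1) = r n := fun n => by
    simp only [r]
    push_cast
    field_simp
    ring
  have hlift : ∀ {m m' : ℕ} {v w s}, m ≤ m' → Approx (G m) (z m) (r m) v w s →
      ∃ w', Approx (G m') (z m') (r m') v w' s := by
    intro m m' v w s hm h
    rcases hm.eq_or_lt with rfl | hlt
    · exact ⟨w, h⟩
    · exact h.change (hGmono hm) (hzG hlt) (hranti hm) (hr0 m).le _
  let U : ℕ → Set Q := fun n => {v | ∃ m ≥ n, ∃ w : Term Q, w.HasVar ∧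
    ∃ s ≤ r n, Approx (G m) (z m) (r m) v w s}
  have hUanti : Antitone U := by
    rintro n n' h v ⟨m, hm, w, hw, s, hs, ha⟩
    exact ⟨m, h.trans hm, w, hw, s, hs.trans (hranti h), ha⟩
  refine hQ.false_of_zero_family U hUanti.directed_ge
    (fun n => ⟨z n, n, le_rfl, .var, trivial, r n, le_rfl, .var le_rfl⟩)
    (fun n => ⟨2 * n + 1, ?_⟩) (fun a n => ?_) (fun a n => ?_) (fun b => ?_)
  · rintro u ⟨m, hm, w, hw, s, hs, ha⟩ u' ⟨m', hm', w', hw', s', hs', ha'⟩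
    have hss : s + s' ≤ r n := by linarith [hr2 n]
    rcases le_total m m' with h | h
    · obtain ⟨v, hv⟩ := hlift h ha
      exact ⟨m', by omega, .mul v w', Or.inr hw', _, hss, hv.mul ha'⟩
    · obtain ⟨v, hv⟩ := hlift h ha'
      exact ⟨m, by omega, .mul w v, Or.inl hw, _, hss, ha.mul hv⟩
  · obtain ⟨i, hi⟩ := hD.exists_dist_lt a (hr0 (2 * n + 1))
    refine ⟨max i (2 * n + 1), ?_⟩
    rintro u ⟨m, hm, w, hw, s, hs, ha⟩
    rw [ge_iff_le, max_le_iff] at hm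
    have hs' := hs.trans (hranti (le_max_right i (2 * n + 1)))
    exact ⟨m, by omega, .mul (.const (D i)) w, Or.inr hw, _, by linarith [hr2 n],
      (Approx.const (hDG hm.1) hi.le (hranti hm.2)).mul ha⟩
  · obtain ⟨i, hi⟩ := hD.exists_dist_lt a (hr0 (2 * n + 1))
    refine ⟨max i (2 * n + 1), ?_⟩
    rintro u ⟨m, hm, w, hw, s, hs, ha⟩
    rw [ge_iff_le, max_le_iff] at hm
    have hs' := hs.trans (hranti (le_max_right i (2 * n + 1)))
    exact ⟨m, by omega, .mul w (.const (D i)), Or.inl hw, _, by linarith [hr2 n],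
      ha.mul (Approx.const (hDG hm.1) hi.le (hranti hm.2))⟩
  · by_cases hb : b ∈ J
    · obtain ⟨k, δ, hδ, hk⟩ := hPloc b hb
      obtain ⟨n, hn⟩ := exists_nat_one_div_lt hδ
      refine ⟨max k n, ?_⟩
      rintro ⟨m, hm, w, hw, s, hs, ha⟩
      rw [ge_iff_le, max_le_iff] at hm
      have hsize : w.size ≤ m + 1 := by
        have h1 : w.size * r m ≤ 1 := ha.size_le.trans (hs.trans
          ((hranti (Nat.zero_le _)).trans (by simp [r])))
        simp only [r, mul_one_div] at h1
        rw [div_le_one (by positivity)] at h1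
        exact_mod_cast h1
      refine (hz m).2 w hw ha.coeffs_subset hsize k (by omega) (hk _ (hJi.ev_mem (hz m).1 hw) ?_)
      exact ((ha.dist_le hd (hr0 m).le).trans (hs.trans (hranti (le_max_right k n)))).trans_lt hn
    · refine ⟨0, ?_⟩
      rintro ⟨m, hm, w, hw, s, hs, ha⟩
      exact hb (ha.mem_of_hasVar hJi (hz m).1 hw)

end Meager

section MinimalIdeal

variable {Q : Type u} [Semigroup Q]

theorem IsIdeal.polyCovered_univ {J : Set Q} (hJ : IsIdeal J) (hne : J.Nonempty)
    (hp : PolyCovered J) : PolyCovered (Set.univ : Set Q) := by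
  obtain ⟨c, hc⟩ := hne
  exact (hp.preimage (u := mul var (const c)) (Or.inl trivial)).mono fun x _ => (hJ c hc x).2

/-- The union of all open sets whose intersection with `J` is covered by finitely many sets of
the form `{x | w(x) = b}`. -/
def polyCoveredLocus [TopologicalSpace Q] (J : Set Q) : Set Q :=
  ⋃₀ {O | IsOpen O ∧ PolyCovered (O ∩ J)}

theorem IsIdeal.sdiff_polyCoveredLocus [TopologicalSpace Q] [ContinuousMul Q] {J : Set Q}
    (hJ : IsIdeal J) : IsIdeal (J \ polyCoveredLocus J) := by
  rintro x ⟨hx, hxN⟩ a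
  refine ⟨⟨(hJ x hx a).1, ?_⟩, ⟨(hJ x hx a).2, ?_⟩⟩
  · rintro ⟨O, ⟨hO, hOJ⟩, hxO⟩
    exact hxN ⟨{y | y * a ∈ O}, ⟨hO.preimage (continuous_mul_const a),
      (hOJ.preimage (u := mul var (const a)) (Or.inl trivial)).mono fun y hy =>
        ⟨hy.1, (hJ y hy.2 a).1⟩⟩, hxO⟩
  · rintro ⟨O, ⟨hO, hOJ⟩, hxO⟩
    exact hxN ⟨{y | a * y ∈ O}, ⟨hO.preimage (continuous_const_mul a),
      (hOJ.preimage (u := mul (const a) var) (Or.inr trivial)).mono fun y hy =>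
        ⟨hy.1, (hJ y hy.2 a).2⟩⟩, hxO⟩

theorem isClosed_sdiff_polyCoveredLocus [TopologicalSpace Q] {J : Set Q} (hJ : IsClosed J) :
    IsClosed (J \ polyCoveredLocus J) :=
  hJ.sdiff (isOpen_sUnion fun _ h => h.1)

theorem ClosedImages.exists_minimal_closed_ideal [Nonempty Q] [TopologicalSpace Q]
    (hQ : ClosedImages Q) :
    ∃ J : Set Q, Minimal (fun J => IsIdeal J ∧ IsClosed J ∧ J.Nonempty) J := by
  refine zorn_superset {J | IsIdeal J ∧ IsClosed J ∧ J.Nonempty} fun c hc hchain => ?_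
  rcases c.eq_empty_or_nonempty with rfl | hne
  · exact ⟨Set.univ, ⟨fun _ _ _ => ⟨trivial, trivial⟩, isClosed_univ, Set.univ_nonempty⟩, by simp⟩
  refine ⟨⋂₀ c, ⟨fun x hx a => ⟨fun J hJ => ((hc hJ).1 x (hx J hJ) a).1,
    fun J hJ => ((hc hJ).1 x (hx J hJ) a).2⟩, isClosed_sInter fun J hJ => (hc hJ).2.1, ?_⟩,
    fun J hJ => Set.sInter_subset_of_mem hJ⟩
  by_contra hemp
  have := hne.to_subtype
  refine hQ.false_of_zero_family (fun J : c => (J : Set Q)) ?_ (fun J => (hc J.2).2.2)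
    (fun J => ⟨J, fun u hu v _ => ((hc J.2).1 u hu v).1⟩)
    (fun a J => ⟨J, fun u hu => ((hc J.2).1 u hu a).2⟩)
    (fun a J => ⟨J, fun u hu => ((hc J.2).1 u hu a).1⟩) (fun b => ?_)
  · intro I J
    rcases hchain.total I.2 J.2 with h | h
    · exact ⟨I, subset_rfl, h⟩
    · exact ⟨J, h, subset_rfl⟩
  · by_contra! hb
    exact hemp ⟨b, fun J hJ => hb ⟨J, hJ⟩⟩

theorem ClosedImages.polyCovered_univ {Q : Type u} [Semigroup Q] [MetricSpace Q]
    [TopologicalSpace.SeparableSpace Q] (hQ : ClosedImages Q)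
    (hd : Subinvariant (dist : Q → Q → ℝ)) (hcov : covMeager = continuum) :
    PolyCovered (Set.univ : Set Q) := by
  rcases isEmpty_or_nonempty Q with hemp | hemp
  · exact PolyCovered.empty.mono fun x _ => (hemp.false x).elim
  by_contra hun
  have := hQ.completeSpace hd
  have := hd.continuousMul
  obtain ⟨J, ⟨hJi, hJc, hJne⟩, hmin⟩ := hQ.exists_minimal_closed_ideal
  have hJ : ¬ PolyCovered J := fun h => hun (hJi.polyCovered_univ hJne h)
  rcases (J \ polyCoveredLocus J).eq_empty_or_nonempty with h | h
  · refine hQ.false_of_locally_polyCovered hd hJi hJ fun x hx => ?_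
    obtain ⟨O, ⟨hO, hOJ⟩, hxO⟩ := Set.sdiff_eq_empty.1 h hx
    exact ⟨O, hO, hxO, hOJ⟩
  · have hsub := hmin ⟨hJi.sdiff_polyCoveredLocus, isClosed_sdiff_polyCoveredLocus hJc, h⟩
      Set.sdiff_subset
    refine hQ.false_of_nowhere_polyCovered hcov hJc hJne ?_
    rintro O hO ⟨x, hxO, hxJ⟩ hOJ
    exact (hsub hxJ).2 ⟨O, ⟨hO, hOJ⟩, hxO⟩

end MinimalIdeal

section Reduction

theorem Term.finite_coeffs {ι : Type*} (w : Term ι) : w.coeffs.Finite := by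
  induction w with
  | var => exact Set.finite_empty
  | const i => exact Set.finite_singleton i
  | mul v w ihv ihw => exact ihv.union ihw

theorem Term.eval_congr {ι X : Type*} [Mul X] {s t : ι → X} (x : X) {w : Term ι}
    (h : ∀ i ∈ w.coeffs, s i = t i) : eval s x w = eval t x w := by
  induction w with
  | var => rfl
  | const i => exact h i rfl
  | mul v w ihv ihw =>
    exact congrArg₂ _ (ihv fun i hi => h i (Or.inl hi)) (ihw fun i hi => h i (Or.inr hi))

theorem IsPseudometric.nonneg {X : Type*} {d : X → X → ℝ} (hd : IsPseudometric d) (x y : X) :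
    0 ≤ d x y := by
  have h := hd.2.2 x y x
  rw [hd.1, hd.2.1 y x] at h
  linarith

theorem exists_metric_quotient {X : Type u} [Semigroup X] {d : X → X → ℝ} (hd : IsPseudometric d)
    (hs : Subinvariant d) :
    ∃ (Q : Type u) (_ : Semigroup Q) (_ : MetricSpace Q) (π : X →ₙ* Q), Function.Surjective π ∧
      Subinvariant (dist : Q → Q → ℝ) ∧ ∀ x y, dist (π x) (π y) = d x y := by
  let : PseudoMetricSpace X :=
    { dist := d
      dist_self := hd.1
      dist_comm := hd.2.1
      dist_triangle := hd.2.2 }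
  have : ContinuousMul X := Subinvariant.continuousMul (Q := X) hs
  have hsurj : Function.Surjective (SeparationQuotient.mk : X → SeparationQuotient X) :=
    SeparationQuotient.surjective_mk
  refine ⟨SeparationQuotient X, inferInstance, inferInstance,
    ⟨SeparationQuotient.mk, SeparationQuotient.mk_mul⟩, hsurj, ⟨?_, ?_⟩, fun x y => rfl⟩
  · intro a x y
    obtain ⟨a, rfl⟩ := hsurj a
    obtain ⟨x, rfl⟩ := hsurj x
    obtain ⟨y, rfl⟩ := hsurj y
    exact hs.1 a x y
  · intro a x y
    obtain ⟨a, rfl⟩ := hsurj a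
    obtain ⟨x, rfl⟩ := hsurj x
    obtain ⟨y, rfl⟩ := hsurj y
    exact hs.2 a x y

/-- The continuous subinvariant pseudometrics on a topologized semigroup. -/
def contSubinvariant (X : Type*) [Semigroup X] [TopologicalSpace X] : Set (X → X → ℝ) :=
  {d | IsPseudometric d ∧ Subinvariant d ∧ Continuous (Function.uncurry d)}

theorem min_one_add_le {a b : ℝ} (ha : 0 ≤ a) (hb : 0 ≤ b) :
    min 1 (a + b) ≤ min 1 a + min 1 b := by
  grind

theorem exists_contSubinvariant_sum {X : Type*} [Semigroup X] [TopologicalSpace X]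
    (d : ℕ → X → X → ℝ) (hd : ∀ i, d i ∈ contSubinvariant X) :
    ∃ D ∈ contSubinvariant X, ∀ i x y, 0 < d i x y → 0 < D x y := by
  let c : ℕ → X → X → ℝ := fun i x y => (1 / 2) ^ i * min 1 (d i x y)
  have hc0 : ∀ i x y, 0 ≤ c i x y := fun i x y =>
    mul_nonneg (by positivity) (le_min zero_le_one ((hd i).1.nonneg x y))
  have hc1 : ∀ i x y, c i x y ≤ (1 / 2) ^ i := fun i x y =>
    mul_le_of_le_one_right (by positivity) (min_le_left _ _)
  have hgeo : Summable fun i : ℕ => (1 / 2 : ℝ) ^ i := summable_geometric_two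
  have hsum : ∀ x y, Summable fun i => c i x y := fun x y =>
    hgeo.of_nonneg_of_le (fun i => hc0 i x y) fun i => hc1 i x y
  refine ⟨fun x y => ∑' i, c i x y, ⟨⟨fun x => ?_, fun x y => ?_, fun x y z => ?_⟩,
    ⟨fun a x y => ?_, fun a x y => ?_⟩, ?_⟩, fun i x y h => ?_⟩
  · simp [c, (hd _).1.1 x]
  · simp [c, (hd _).1.2.1 x y]
  · rw [← (hsum x y).tsum_add (hsum y z)]
    refine (hsum x z).tsum_le_tsum (fun i => ?_) ((hsum x y).add (hsum y z))
    simp only [c, ← mul_add]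
    gcongr
    exact (min_le_min_left _ ((hd i).1.2.2 x y z)).trans
      (min_one_add_le ((hd i).1.nonneg _ _) ((hd i).1.nonneg _ _))
  · refine (hsum _ _).tsum_le_tsum (fun i => ?_) (hsum _ _)
    simp only [c]
    gcongr
    exact (hd i).2.1.1 a x y
  · refine (hsum _ _).tsum_le_tsum (fun i => ?_) (hsum _ _)
    simp only [c]
    gcongr
    exact (hd i).2.1.2 a x y
  · refine continuous_tsum (fun i => ?_) hgeo fun i p => ?_
    · exact continuous_const.mul (continuous_const.min (hd i).2.2)
    · rw [Real.norm_of_nonneg (hc0 _ _ _)]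
      exact hc1 _ _ _
  · exact (hsum x y).tsum_pos (fun i => hc0 i x y) i
      (mul_pos (by positivity) (lt_min one_pos h))

open Filter Topology in
theorem tendsto_dist_eval {X ι : Type*} [Semigroup X] [TopologicalSpace X] {d : X → X → ℝ}
    (hd : d ∈ contSubinvariant X) (t : ι → X) (x : X) (w : Term ι) :
    Tendsto (fun t' : ι → X => d (eval t' x w) (eval t x w)) (𝓝 t) (𝓝 0) := by
  have h0 : ∀ a b, 0 ≤ d a b := hd.1.nonneg
  induction w with
  | var => simp [eval, hd.1.1]
  | const i =>
    have hc : Continuous fun t' : ι → X => d (t' i) (t i) :=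
      Continuous.comp (g := Function.uncurry d) (f := fun t' : ι → X => (t' i, t i)) hd.2.2
        ((continuous_apply i).prodMk continuous_const)
    simpa [eval, hd.1.1] using hc.tendsto t
  | mul v w ihv ihw =>
    refine squeeze_zero (fun _ => h0 _ _) (fun t' => ?_) (by simpa using ihv.add ihw)
    simp only [eval]
    refine (hd.1.2.2 _ (eval t x v * eval t' x w) _).trans (add_le_add ?_ ?_)
    · exact hd.2.1.2 _ _ _
    · exact hd.2.1.1 _ _ _

open Filter Topology in
theorem eventually_dist_eval_pos {X ι : Type*} [Semigroup X] [TopologicalSpace X]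
    {d : X → X → ℝ} (hd : d ∈ contSubinvariant X) {t : ι → X} {x : X} {w : Term ι} {j : ι}
    (h : 0 < d (eval t x w) (t j)) : ∀ᶠ t' in 𝓝 t, 0 < d (eval t' x w) (t' j) := by
  have h1 := tendsto_dist_eval hd t x w
  have h2 := tendsto_dist_eval hd t x (const j)
  have h3 := h1.add h2
  rw [add_zero] at h3
  filter_upwards [h3.eventually (gt_mem_nhds h)] with t' ht'
  simp only [eval] at ht'
  have e1 := hd.1.2.2 (eval t x w) (eval t' x w) (t j)
  have e2 := hd.1.2.2 (eval t' x w) (t' j) (t j)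
  have e3 := hd.1.2.1 (eval t x w) (eval t' x w)
  linarith

theorem exists_countable_separating {X : Type u} [Semigroup X] [TopologicalSpace X]
    (hsubinv : ∀ x y : X, x ≠ y → ∃ d ∈ contSubinvariant X, 0 < d x y)
    (hX : ¬ PolyCovered (Set.univ : Set X)) {n : ℕ} [LindelofSpace (Fin n → X)]
    (E : Finset (Term (Fin n) × Fin n)) (hE : ∀ p ∈ E, p.1.HasVar) :
    ∃ S ⊆ contSubinvariant X, S.Countable ∧
      ∀ t : Fin n → X, ∃ x, ∀ p ∈ E, ∃ d ∈ S, 0 < d (eval t x p.1) (t p.2) := by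
  have h1 : ∀ t : Fin n → X, ∃ x, ∀ p ∈ E, eval t x p.1 ≠ t p.2 := by
    intro t
    by_contra! hcon
    refine hX ⟨(fun p => (Term.map t p.1, t p.2)) '' (E : Set (Term (Fin n) × Fin n)),
      E.finite_toSet.image _, ?_, fun x _ => ?_⟩
    · rintro _ ⟨p, hp, rfl⟩
      exact (hasVar_map _ _).2 (hE p hp)
    · obtain ⟨p, hp, h⟩ := hcon x
      exact ⟨_, ⟨p, hp, rfl⟩, by simpa [ev, eval_map] using h⟩
  choose x hx using h1
  have h2 : ∀ (t : Fin n → X) (p : Term (Fin n) × Fin n), ∃ d, p ∈ E →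
      d ∈ contSubinvariant X ∧ 0 < d (eval t (x t) p.1) (t p.2) := by
    intro t p
    by_cases hp : p ∈ E
    · obtain ⟨d, hd, h⟩ := hsubinv _ _ (hx t p hp)
      exact ⟨d, fun _ => ⟨hd, h⟩⟩
    · exact ⟨fun _ _ => 0, fun h => absurd h hp⟩
  choose d hd using h2
  obtain ⟨T, hT, hTU⟩ := LindelofSpace.elim_nhds_subcover
    (fun t : Fin n → X => {t' | ∀ p ∈ E, 0 < d t p (eval t' (x t) p.1) (t' p.2)}) fun t =>
      (Finset.eventually_all E).2 fun p hp => eventually_dist_eval_pos (hd t p hp).1 (hd t p hp).2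
  refine ⟨⋃ t ∈ T, d t '' (E : Set (Term (Fin n) × Fin n)), ?_,
    hT.biUnion fun t _ => (E.finite_toSet.image _).countable, fun t' => ?_⟩
  · simp only [Set.iUnion_subset_iff]
    rintro t - _ ⟨p, hp, rfl⟩
    exact (hd t p hp).1
  · have ht' : t' ∈ ⋃ t ∈ T, {t' | ∀ p ∈ E, 0 < d t p (eval t' (x t) p.1) (t' p.2)} := by
      rw [hTU]; trivial
    simp only [Set.mem_iUnion] at ht'
    obtain ⟨t, ht, h⟩ := ht'
    exact ⟨x t, fun p hp => ⟨d t p, Set.mem_biUnion ht ⟨p, hp, rfl⟩, h p hp⟩⟩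

theorem exists_separating_pseudometric {X : Type u} [Semigroup X] [TopologicalSpace X]
    (hPL : PowerLindelof X)
    (hsubinv : ∀ x y : X, x ≠ y → ∃ d ∈ contSubinvariant X, 0 < d x y)
    (hX : ¬ PolyCovered (Set.univ : Set X)) :
    ∃ D ∈ contSubinvariant X, ∀ (n : ℕ) (E : Finset (Term (Fin n) × Fin n)),
      (∀ p ∈ E, p.1.HasVar) →
      ∀ t : Fin n → X, ∃ x, ∀ p ∈ E, 0 < D (eval t x p.1) (t p.2) := by
  let I := {q : Σ n : ℕ, Finset (Term (Fin n) × Fin n) // ∀ p ∈ q.2, p.1.HasVar}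
  choose S hS hSc hSsep using fun q : I =>
    have := hPL q.1.1
    exists_countable_separating hsubinv hX q.1.2 q.2
  have hzero : (fun _ _ => 0 : X → X → ℝ) ∈ contSubinvariant X :=
    ⟨⟨by simp, by simp, by simp⟩, ⟨by simp, by simp⟩, continuous_const⟩
  obtain ⟨d, hd⟩ := ((Set.countable_iUnion hSc).insert (fun _ _ => 0)).exists_eq_range
    (Set.insert_nonempty _ _)
  have hdmem : ∀ i, d i ∈ contSubinvariant X := by
    intro i
    have : d i ∈ insert (fun _ _ => 0) (⋃ q, S q) := hd ▸ Set.mem_range_self i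
    rcases this with h | h
    · rw [h]; exact hzero
    · obtain ⟨q, hq⟩ := Set.mem_iUnion.1 h
      exact hS q hq
  obtain ⟨D, hD, hDpos⟩ := exists_contSubinvariant_sum d hdmem
  refine ⟨D, hD, fun n E hE t => ?_⟩
  obtain ⟨x, hx⟩ := hSsep ⟨⟨n, E⟩, hE⟩ t
  refine ⟨x, fun p hp => ?_⟩
  obtain ⟨d', hd', hpos⟩ := hx p hp
  obtain ⟨i, rfl⟩ : d' ∈ Set.range d := hd ▸ Or.inr (Set.mem_iUnion.2 ⟨_, hd'⟩)
  exact hDpos i _ _ hpos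

theorem not_polyCovered_univ_of_separating {X Q : Type*} [Semigroup X] [Semigroup Q]
    [Nonempty Q] (π : X →ₙ* Q) (hπ : Function.Surjective π)
    (h : ∀ (n : ℕ) (E : Finset (Term (Fin n) × Fin n)), (∀ p ∈ E, p.1.HasVar) →
      ∀ t : Fin n → X, ∃ x, ∀ p ∈ E, π (eval t x p.1) ≠ π (t p.2)) :
    ¬ PolyCovered (Set.univ : Set Q) := by
  classical
  rintro ⟨E, hE, hv, hc⟩
  obtain ⟨q⟩ := ‹Nonempty Q›
  obtain ⟨n, t, -, ht⟩ :=
    ((hE.biUnion fun p _ => p.1.finite_coeffs.union (Set.finite_singleton p.2)).insert q).fin_param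
  have : Nonempty (Fin n) := by
    obtain ⟨i, -⟩ := ht.symm ▸ Set.mem_insert q (⋃ p ∈ E, p.1.coeffs ∪ {p.2})
    exact ⟨i⟩
  let g := Function.invFun t
  have hg : ∀ p ∈ E, ∀ a ∈ p.1.coeffs ∪ {p.2}, t (g a) = a := fun p hp a ha =>
    Function.invFun_eq (f := t) (b := a) (show a ∈ Set.range t from
      ht ▸ Or.inr (Set.mem_biUnion hp ha))
  choose l hl using hπ
  obtain ⟨x, hx⟩ := h n (hE.toFinset.image fun p => (Term.map g p.1, g p.2)) (by
    intro p' hp'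
    obtain ⟨p, hp, rfl⟩ := Finset.mem_image.1 hp'
    exact (hasVar_map _ _).2 (hv p (hE.mem_toFinset.1 hp))) (l ∘ t)
  obtain ⟨p, hp, hpx⟩ := hc (π x) trivial
  refine hx _ (Finset.mem_image_of_mem _ (hE.mem_toFinset.2 hp)) ?_
  have hlt : π ∘ l ∘ t = t := funext fun i => hl _
  rw [map_eval, hlt, eval_map, Function.comp_apply, hl, hg p hp p.2 (Or.inr rfl), ← hpx]
  exact eval_congr _ fun a ha => hg p hp a (Or.inl ha)

end Reduction

/-- Under `cov(M) = 𝔠`, a semigroup `X` admitting a power-Lindelöf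
subinvariant topology is polybounded provided the image of `X` is closed under every
homomorphism into a Tychonoff (completely regular Hausdorff) topological semigroup. -/
theorem statement19 {X : Type u} [Semigroup X] [TopologicalSpace X]
    (hPL : PowerLindelof X)
    (hsubinv : ∀ x y : X, x ≠ y → ∃ d : X → X → ℝ, IsPseudometric d ∧
      Subinvariant d ∧ Continuous (Function.uncurry d) ∧ 0 < d x y)
    (hcov : covMeager = Cardinal.continuum)
    (hTych : ∀ (Y : Type u) [Semigroup Y] [TopologicalSpace Y],
      ∀ [ContinuousMul Y] [CompletelyRegularSpace Y] [T2Space Y],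
      ∀ f : X →ₙ* Y, IsClosed (Set.range f)) :
    Polybounded X := by
  refine PolyCovered.polybounded ?_
  by_contra hX
  obtain ⟨D, hD, hsep⟩ := exists_separating_pseudometric hPL (fun x y hxy => by
    obtain ⟨d, h1, h2, h3, h4⟩ := hsubinv x y hxy
    exact ⟨d, ⟨h1, h2, h3⟩, h4⟩) hX
  obtain ⟨Q, _, _, π, hπ, hd, hdist⟩ := exists_metric_quotient hD.1 hD.2.1
  have hcont : Continuous π := by
    refine continuous_iff_continuousAt.2 fun x => tendsto_iff_dist_tendsto_zero.2 ?_
    have hc : Continuous fun y => D y x := hD.2.2.comp (continuous_id.prodMk continuous_const)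
    simpa only [hdist, hD.1.1] using hc.tendsto x
  have hsurj : Function.Surjective fun t : Fin 1 → X => π (t 0) := fun q => by
    obtain ⟨x, rfl⟩ := hπ q
    exact ⟨fun _ => x, rfl⟩
  have : LindelofSpace (Fin 1 → X) := hPL 1
  have : LindelofSpace Q := ⟨by
    rw [← hsurj.range_eq]
    exact isLindelof_range (hcont.comp (continuous_apply 0))⟩
  have hne : Nonempty Q := by
    by_contra hemp
    rw [not_nonempty_iff] at hemp
    exact hX (PolyCovered.empty.mono fun x _ => (hemp.false (π x)).elim)
  refine not_polyCovered_univ_of_separating π hπ (fun n E hE t => ?_)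
    (ClosedImages.polyCovered_univ (ClosedImages.of_surjective hTych π hπ) hd hcov)
  obtain ⟨x, hx⟩ := hsep n E hE t
  refine ⟨x, fun p hp h => (hx p hp).ne' ?_⟩
  rw [← hdist, h, dist_self]

end ZeroClosedPaper
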